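/- arXiv:1612.08819 — 3 statements merged into one kernel-verified Lean document; each statement's English description precedes it below -/
import Mathlib

section
/- Let 1 ≤ q₁ < q₂ ≤ p < ∞. Then for every measurable function f on ℝⁿ, ‖f‖_{M^p_{q₁}} ≤ 2 (q₁/(q₂ − q₁))^{1/q₂} ‖f‖_{WM^p_{q₂}}; in particular the weak Morrey space WM^p_{q₂} is contained in the Morrey space M^p_{q₁}. -/
open MeasureTheory ENNReal

noncomputable section

/-- `ℝⁿ` with the Euclidean norm. -/
abbrev En (n : ℕ) := EuclideanSpace ℝ (Fin n)

/-- The open cube in `ℝⁿ` centered at `c` with half side length `r`. -/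
def cube {n : ℕ} (c : En n) (r : ℝ) : Set (En n) := {y | ∀ i, |y i - c i| < r}

/-- Morrey norm `‖f‖_{M^p_q}`. -/
def morreyNorm {n : ℕ} (p q : ℝ) (f : En n → ℂ) : ℝ≥0∞ :=
  ⨆ (c : En n) (r : ℝ) (_ : 0 < r),
    volume (cube c r) ^ (1 / p - 1 / q) *
      (∫⁻ y in cube c r, (‖f y‖₊ : ℝ≥0∞) ^ q) ^ (1 / q)

/-- Weak Morrey norm `‖f‖_{WM^p_q}`. -/
def weakMorreyNorm {n : ℕ} (p q : ℝ) (f : En n → ℂ) : ℝ≥0∞ :=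
  ⨆ (c : En n) (r : ℝ) (_ : 0 < r),
    volume (cube c r) ^ (1 / p - 1 / q) *
      ⨆ (t : ℝ) (_ : 0 < t),
        (ENNReal.ofReal t ^ q * volume {y ∈ cube c r | t < ‖f y‖}) ^ (1 / q)

/-- Weak Lebesgue quasinorm `‖f‖_{L^{p,∞}}`. -/
def weakLpNorm {n : ℕ} (p : ℝ) (f : En n → ℂ) : ℝ≥0∞ :=
  ⨆ (t : ℝ) (_ : 0 < t),
    ENNReal.ofReal t * volume {x : En n | t < ‖f x‖} ^ (1 / p)

/-- The average `b_Q` of `b` over the cube `Q = cube c r`. -/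
def cubeAvg {n : ℕ} (b : En n → ℝ) (c : En n) (r : ℝ) : ℝ :=
  (∫ x in cube c r, b x) / (volume (cube c r)).toReal

/-- The BMO seminorm `‖b‖_*`. -/
def bmoSeminorm {n : ℕ} (b : En n → ℝ) : ℝ≥0∞ :=
  ⨆ (c : En n) (r : ℝ) (_ : 0 < r),
    (volume (cube c r))⁻¹ *
      ∫⁻ x in cube c r, (‖b x - cubeAvg b c r‖₊ : ℝ≥0∞)

/-- The Lipschitz (Hölder) seminorm `‖b‖_{Lip_α}`. -/
def lipSeminorm {n : ℕ} (α : ℝ) (b : En n → ℝ) : ℝ≥0∞ :=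
  ⨆ (x : En n) (y : En n) (_ : x ≠ y),
    (‖b x - b y‖₊ : ℝ≥0∞) / edist x y ^ α

/-- `sup_Q |Q|^{-(1+α/n)} ∫_Q |b - b_Q|`. -/
def lipAvgNorm {n : ℕ} (α : ℝ) (b : En n → ℝ) : ℝ≥0∞ :=
  ⨆ (c : En n) (r : ℝ) (_ : 0 < r),
    volume (cube c r) ^ (-(1 + α / (n : ℝ))) *
      ∫⁻ x in cube c r, (‖b x - cubeAvg b c r‖₊ : ℝ≥0∞)

lemma layer_aux {α : Type*} [MeasurableSpace α] (μ : Measure α) {q₁ q₂ V K R : ℝ}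
    (hq₁ : 1 ≤ q₁) (hq₁q₂ : q₁ < q₂) (hV : 0 < V) (hK : 0 < K) (hR : 0 < R)
    (hRe : R ^ q₂ * V = q₁ / (q₂ - q₁) * K ^ q₂)
    (g : α → ℝ) (hg : Measurable g) (hg0 : ∀ x, 0 ≤ g x)
    (hμ : μ Set.univ ≤ ENNReal.ofReal V)
    (hw : ∀ t : ℝ, 0 < t → μ {x | t < g x} ≤ ENNReal.ofReal (K ^ q₂ * t ^ (-q₂))) :
    ∫⁻ x, ENNReal.ofReal (g x ^ q₁) ∂μ ≤ ENNReal.ofReal (2 * V * R ^ q₁) := by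
  have hq0 : 0 < q₁ := by linarith
  have hd : 0 < q₂ - q₁ := by linarith
  have hKq : 0 < K ^ q₂ := Real.rpow_pos_of_pos hK _
  rw [lintegral_rpow_eq_lintegral_meas_lt_mul μ (Filter.Eventually.of_forall hg0)
    hg.aemeasurable hq0]
  rw [← Set.Ioc_union_Ioi_eq_Ioi hR.le,
    lintegral_union measurableSet_Ioi (Set.Ioc_disjoint_Ioi le_rfl)]
  have h1 : ∫⁻ t in Set.Ioc 0 R, μ {x | t < g x} * ENNReal.ofReal (t ^ (q₁ - 1))
      ≤ ENNReal.ofReal (V * (R ^ q₁ / q₁)) := by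
    have hi : ∫ t in Set.Ioc 0 R, V * t ^ (q₁ - 1) = V * (R ^ q₁ / q₁) := by
      rw [integral_const_mul, ← intervalIntegral.integral_of_le hR.le,
        integral_rpow (Or.inl (by linarith))]
      simp [Real.zero_rpow hq0.ne']
    have hint : IntegrableOn (fun t : ℝ => V * t ^ (q₁ - 1)) (Set.Ioc 0 R) := by
      have := (intervalIntegral.intervalIntegrable_rpow' (a := 0) (b := R)
        (r := q₁ - 1) (by linarith)).const_mul V
      exact (intervalIntegrable_iff_integrableOn_Ioc_of_le hR.le).1 this
    rw [← hi, ofReal_integral_eq_lintegral_ofReal hint]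
    · refine setLIntegral_mono' measurableSet_Ioc fun t ht => ?_
      rw [ENNReal.ofReal_mul hV.le]
      gcongr
      exact (measure_mono (Set.subset_univ _)).trans hμ
    · refine (ae_restrict_mem measurableSet_Ioc).mono fun t ht => ?_
      have := ht.1
      simp only [Pi.zero_apply]
      positivity
  have h2 : ∫⁻ t in Set.Ioi R, μ {x | t < g x} * ENNReal.ofReal (t ^ (q₁ - 1))
      ≤ ENNReal.ofReal (K ^ q₂ * (R ^ (q₁ - q₂) / (q₂ - q₁))) := by
    have hi : ∫ t in Set.Ioi R, K ^ q₂ * t ^ (q₁ - q₂ - 1)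
        = K ^ q₂ * (R ^ (q₁ - q₂) / (q₂ - q₁)) := by
      rw [integral_const_mul, integral_Ioi_rpow_of_lt (by linarith) hR]
      rw [sub_add_cancel, ← neg_sub q₂ q₁, neg_div_neg_eq]
    have hint : IntegrableOn (fun t : ℝ => K ^ q₂ * t ^ (q₁ - q₂ - 1)) (Set.Ioi R) :=
      (integrableOn_Ioi_rpow_of_lt (by linarith) hR).const_mul _
    rw [← hi, ofReal_integral_eq_lintegral_ofReal hint]
    · refine setLIntegral_mono' measurableSet_Ioi fun t ht => ?_
      have ht0 : 0 < t := hR.trans ht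
      have : K ^ q₂ * t ^ (q₁ - q₂ - 1) = K ^ q₂ * t ^ (-q₂) * t ^ (q₁ - 1) := by
        rw [mul_assoc, ← Real.rpow_add ht0]; congr 2; ring
      rw [this, ENNReal.ofReal_mul (by positivity)]
      gcongr
      exact hw t ht0
    · refine (ae_restrict_mem measurableSet_Ioi).mono fun t ht => ?_
      have ht0 : 0 < t := hR.trans ht
      simp only [Pi.zero_apply]
      positivity
  calc _ ≤ ENNReal.ofReal q₁ * (ENNReal.ofReal (V * (R ^ q₁ / q₁)) +
        ENNReal.ofReal (K ^ q₂ * (R ^ (q₁ - q₂) / (q₂ - q₁)))) := by gcongr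
    _ = ENNReal.ofReal (2 * V * R ^ q₁) := by
      rw [← ENNReal.ofReal_add (by positivity) (by positivity), ← ENNReal.ofReal_mul hq0.le]
      congr 1
      have e : R ^ q₁ = R ^ q₂ * R ^ (q₁ - q₂) := by
        rw [← Real.rpow_add hR]; congr 1; ring
      have e2 : q₁ * (K ^ q₂ * (R ^ (q₁ - q₂) / (q₂ - q₁))) = V * R ^ q₁ := by
        rw [e]
        calc _ = (q₁ / (q₂ - q₁) * K ^ q₂) * R ^ (q₁ - q₂) := by ring
          _ = _ := by rw [← hRe]; ring
      rw [mul_add, e2]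
      field_simp
      ring

lemma cube_meas {n : ℕ} (c : En n) (r : ℝ) : IsOpen (cube c r) := by
  have : cube c r = ⋂ i, {y : En n | |y i - c i| < r} := by ext; simp [cube]
  rw [this]
  refine isOpen_iInter_of_finite fun i => isOpen_lt (by fun_prop) continuous_const

lemma cube_vol_pos {n : ℕ} (c : En n) (r : ℝ) (hr : 0 < r) : 0 < volume (cube c r) :=
  (cube_meas c r).measure_pos volume ⟨c, by simp [cube, hr]⟩

lemma cube_vol_lt_top {n : ℕ} (c : En n) (r : ℝ) : volume (cube c r) < ⊤ := by
  have h : cube c r ⊆ (WithLp.ofLp : En n → Fin n → ℝ) ⁻¹' (Metric.closedBall c.ofLp |r|) := by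
    intro y hy
    simp only [Set.mem_preimage, Metric.mem_closedBall]
    refine (dist_pi_le_iff (abs_nonneg r)).2 fun i => ?_
    rw [Real.dist_eq]
    exact (hy i).le.trans (le_abs_self r)
  refine (measure_mono h).trans_lt ?_
  have h2 := (EuclideanSpace.volume_preserving_symm_measurableEquiv_toLp (Fin n)).measure_preimage
    (measurableSet_closedBall (x := c.ofLp) (ε := |r|)).nullMeasurableSet
  exact (le_of_eq h2).trans_lt measure_closedBall_lt_top

lemma cube_bound {n : ℕ} {p q₁ q₂ : ℝ}
    (hq₁ : 1 ≤ q₁) (hq₁q₂ : q₁ < q₂)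
    (f : En n → ℂ) (hf : Measurable f) (c : En n) (r : ℝ) (hr : 0 < r) (K : ℝ) (hK : 0 < K)
    (hW : (⨆ (t : ℝ) (_ : 0 < t),
        (ENNReal.ofReal t ^ q₂ * volume {y ∈ cube c r | t < ‖f y‖}) ^ (1 / q₂))
        ≤ ENNReal.ofReal K) :
    volume (cube c r) ^ (1 / p - 1 / q₁) *
      (∫⁻ y in cube c r, (‖f y‖₊ : ℝ≥0∞) ^ q₁) ^ (1 / q₁) ≤
    ENNReal.ofReal (2 * (q₁ / (q₂ - q₁)) ^ (1 / q₂)) *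
      (volume (cube c r) ^ (1 / p - 1 / q₂) * ENNReal.ofReal K) := by
  have hq0 : 0 < q₁ := by linarith
  have hq20 : 0 < q₂ := by linarith
  have hd : 0 < q₂ - q₁ := by linarith
  set V := (volume (cube c r)).toReal with hVdef
  have hV : 0 < V := ENNReal.toReal_pos (cube_vol_pos c r hr).ne' (cube_vol_lt_top c r).ne
  have hVe : volume (cube c r) = ENNReal.ofReal V :=
    (ENNReal.ofReal_toReal (cube_vol_lt_top c r).ne).symm
  set a := q₁ / (q₂ - q₁) with ha_def
  have ha : 0 < a := by positivity
  set R := a ^ (1 / q₂) * K * V ^ (-(1 / q₂)) with hRdef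
  have hR : 0 < R := by positivity
  have hRe : R ^ q₂ * V = a * K ^ q₂ := by
    rw [hRdef, Real.mul_rpow (by positivity) (by positivity),
      Real.mul_rpow (by positivity) (by positivity), ← Real.rpow_mul ha.le,
      ← Real.rpow_mul hV.le, neg_mul, one_div_mul_cancel hq20.ne', Real.rpow_one,
      Real.rpow_neg_one]
    field_simp
  have hw : ∀ t : ℝ, 0 < t → (volume.restrict (cube c r)) {x | t < ‖f x‖} ≤
      ENNReal.ofReal (K ^ q₂ * t ^ (-q₂)) := by
    intro t ht
    rw [Measure.restrict_apply (measurableSet_lt measurable_const hf.norm)]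
    have h1 : (ENNReal.ofReal t ^ q₂ * volume {y ∈ cube c r | t < ‖f y‖}) ^ (1 / q₂)
        ≤ ENNReal.ofReal K := (le_iSup₂_of_le t ht le_rfl).trans hW
    rw [one_div, ENNReal.rpow_inv_le_iff hq20, ENNReal.ofReal_rpow_of_pos ht,
      ENNReal.ofReal_rpow_of_pos hK] at h1
    have htq : 0 < t ^ q₂ := Real.rpow_pos_of_pos ht _
    have hset : {x | t < ‖f x‖} ∩ cube c r = {y ∈ cube c r | t < ‖f y‖} := by
      ext; simp [and_comm]
    rw [hset, Real.rpow_neg ht.le, ← div_eq_mul_inv, ENNReal.ofReal_div_of_pos htq,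
      ENNReal.le_div_iff_mul_le (Or.inl (by simpa using htq)) (Or.inl ENNReal.ofReal_ne_top),
      mul_comm]
    exact h1
  have key := layer_aux (volume.restrict (cube c r)) hq₁ hq₁q₂ hV hK hR hRe
    (fun x => ‖f x‖) hf.norm (fun x => norm_nonneg _) (by simp [hVe]) hw
  have hI : (∫⁻ y in cube c r, (‖f y‖₊ : ℝ≥0∞) ^ q₁) ≤ ENNReal.ofReal (2 * V * R ^ q₁) := by
    refine le_trans (le_of_eq ?_) key
    refine lintegral_congr fun x => ?_
    rw [← ENNReal.ofReal_rpow_of_nonneg (norm_nonneg _) hq0.le, ofReal_norm]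
    rfl
  calc _ ≤ volume (cube c r) ^ (1 / p - 1 / q₁) *
        ENNReal.ofReal (2 * V * R ^ q₁) ^ (1 / q₁) := by gcongr
    _ ≤ _ := by
      rw [hVe, ENNReal.ofReal_rpow_of_pos hV, ENNReal.ofReal_rpow_of_pos hV,
        ENNReal.ofReal_rpow_of_pos (by positivity), ← ENNReal.ofReal_mul (by positivity),
        ← ENNReal.ofReal_mul (by positivity), ← ENNReal.ofReal_mul (by positivity)]
      apply ENNReal.ofReal_le_ofReal
      rw [Real.mul_rpow (by positivity) (by positivity),
        Real.mul_rpow (by positivity) (by positivity), ← Real.rpow_mul hR.le,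
        mul_one_div_cancel hq0.ne', Real.rpow_one]
      have e1 : V ^ (1 / p - 1 / q₁) * V ^ (1 / q₁) = V ^ (1 / p) := by
        rw [← Real.rpow_add hV]; congr 1; ring
      have e2 : V ^ (1 / p) * V ^ (-(1 / q₂)) = V ^ (1 / p - 1 / q₂) := by
        rw [← Real.rpow_add hV]; congr 1
      have e3 : (2 : ℝ) ^ (1 / q₁) ≤ 2 := by
        calc (2 : ℝ) ^ (1 / q₁) ≤ 2 ^ (1 : ℝ) :=
              Real.rpow_le_rpow_of_exponent_le (by norm_num) (by
                rw [div_le_one hq0]; exact hq₁)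
          _ = 2 := Real.rpow_one 2
      calc _ = 2 ^ (1 / q₁) * ((V ^ (1 / p - 1 / q₁) * V ^ (1 / q₁)) * R) := by ring
        _ ≤ 2 * ((V ^ (1 / p - 1 / q₁) * V ^ (1 / q₁)) * R) := by gcongr
        _ = 2 * (a ^ (1 / q₂) * (V ^ (1 / p) * V ^ (-(1 / q₂))) * K) := by
          rw [e1, hRdef]; ring
        _ = _ := by rw [e2]; ring

/-- For `1 ≤ q₁ < q₂ ≤ p < ∞`,
`‖f‖_{M^p_{q₁}} ≤ 2 (q₁/(q₂ - q₁))^{1/q₂} ‖f‖_{WM^p_{q₂}}`, so `WM^p_{q₂} ⊆ M^p_{q₁}`. -/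
theorem morrey_le_weakMorrey {n : ℕ} {p q₁ q₂ : ℝ}
    (hq₁ : 1 ≤ q₁) (hq₁q₂ : q₁ < q₂) (hq₂p : q₂ ≤ p)
    (f : En n → ℂ) (hf : Measurable f) :
    morreyNorm p q₁ f ≤
      ENNReal.ofReal (2 * (q₁ / (q₂ - q₁)) ^ (1 / q₂)) * weakMorreyNorm p q₂ f := by
  have hd : 0 < q₂ - q₁ := by linarith
  have hq0 : 0 < q₁ := by linarith
  have hC : 0 < 2 * (q₁ / (q₂ - q₁)) ^ (1 / q₂) := by positivity
  unfold morreyNorm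
  refine iSup_le fun c => iSup_le fun r => iSup_le fun hr => ?_
  set W := ⨆ (t : ℝ) (_ : 0 < t),
        (ENNReal.ofReal t ^ q₂ * volume {y ∈ cube c r | t < ‖f y‖}) ^ (1 / q₂) with hWdef
  have hle : volume (cube c r) ^ (1 / p - 1 / q₂) * W ≤ weakMorreyNorm p q₂ f := by
    unfold weakMorreyNorm
    exact le_iSup_of_le c (le_iSup_of_le r (le_iSup_of_le hr le_rfl))
  refine le_trans ?_ (mul_le_mul_right hle _)
  have hv0 := (cube_vol_pos c r hr).ne'
  have hvt := (cube_vol_lt_top c r).ne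
  set D := ENNReal.ofReal (2 * (q₁ / (q₂ - q₁)) ^ (1 / q₂)) *
    volume (cube c r) ^ (1 / p - 1 / q₂) with hD
  have hD0 : D ≠ 0 := mul_ne_zero (by simpa using hC)
    (ENNReal.rpow_pos (cube_vol_pos c r hr) hvt).ne'
  have hDt : D ≠ ⊤ := ENNReal.mul_ne_top ENNReal.ofReal_ne_top
    (ENNReal.rpow_ne_top_of_ne_zero hv0 hvt)
  rw [← mul_assoc, mul_comm, ← hD, mul_comm D, ← ENNReal.div_le_iff hD0 hDt]
  refine le_of_forall_gt_imp_ge_of_dense fun K hK => ?_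
  rcases eq_or_ne K ⊤ with rfl | hKt
  · exact le_top
  rw [ENNReal.div_le_iff hD0 hDt, mul_comm K, mul_comm, hD, mul_assoc]
  have hKpos : 0 < K.toReal := ENNReal.toReal_pos (bot_le.trans_lt hK).ne' hKt
  have := cube_bound (p := p) hq₁ hq₁q₂ f hf c r hr K.toReal hKpos
    (by rw [ENNReal.ofReal_toReal hKt]; exact hK.le)
  rwa [ENNReal.ofReal_toReal hKt] at this
end
end

section
/- Let 0 < α < 1 and let b : ℝⁿ → ℝ be continuous. Then there exist positive constants c₁, c₂ depending only on n and α such that c₁ ‖b‖_{Lip_α} ≤ sup_Q |Q|^{−(1+α/n)} ∫_Q |b(x) − b_Q| dx ≤ c₂ ‖b‖_{Lip_α}, where the supremum is taken over all cubes Q ⊂ ℝⁿ (either side may be infinite, in which case both are). -/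
open MeasureTheory ENNReal

noncomputable section

namespace LipAux

lemma cube_eq {n : ℕ} (c : En n) {r : ℝ} (hr : 0 < r) :
    cube c r = (WithLp.ofLp : En n → (Fin n → ℝ)) ⁻¹' (Metric.ball (WithLp.ofLp c) r) := by
  ext y
  simp only [cube, Set.mem_setOf_eq, Set.mem_preimage, Metric.mem_ball, dist_pi_lt_iff hr,
    Real.dist_eq]

lemma isOpen_cube {n : ℕ} (c : En n) {r : ℝ} (hr : 0 < r) : IsOpen (cube c r) := by
  rw [cube_eq c hr]
  exact Metric.isOpen_ball.preimage (PiLp.continuous_ofLp 2 _)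

lemma volume_cube {n : ℕ} (c : En n) {r : ℝ} (hr : 0 < r) :
    volume (cube c r) = ENNReal.ofReal ((2 * r) ^ n) := by
  rw [cube_eq c hr, (PiLp.volume_preserving_ofLp (Fin n)).measure_preimage
    Metric.isOpen_ball.measurableSet.nullMeasurableSet, Real.volume_pi_ball _ hr]
  simp

lemma norm_sub_le {n : ℕ} {c x : En n} {r : ℝ} (hr : 0 < r) (h : ∀ i, |x i - c i| ≤ r) :
    ‖x - c‖ ≤ Real.sqrt n * r := by
  rw [EuclideanSpace.norm_eq]
  have : ∑ i, ‖(x - c) i‖ ^ 2 ≤ n * r ^ 2 := by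
    calc ∑ i, ‖(x - c) i‖ ^ 2 ≤ ∑ _i : Fin n, r ^ 2 := by
          refine Finset.sum_le_sum fun i _ => ?_
          have := h i
          simp only [PiLp.sub_apply, Real.norm_eq_abs]
          gcongr
      _ = n * r ^ 2 := by simp
  calc Real.sqrt _ ≤ Real.sqrt (n * r ^ 2) := Real.sqrt_le_sqrt this
    _ = _ := by rw [Real.sqrt_mul (by positivity), Real.sqrt_sq hr.le]

lemma integrableOn {n : ℕ} {b : En n → ℝ} (hb : Continuous b) (c : En n) {r : ℝ} (hr : 0 < r) :
    IntegrableOn b (cube c r) := by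
  have h : cube c r ⊆ Metric.closedBall c (Real.sqrt n * r) := by
    intro x hx
    rw [Metric.mem_closedBall, dist_eq_norm]
    exact norm_sub_le hr fun i => (hx i).le
  exact (hb.continuousOn.integrableOn_compact (isCompact_closedBall _ _)).mono_set h

lemma vol_real {n : ℕ} (c : En n) {r : ℝ} (hr : 0 < r) :
    (volume (cube c r)).toReal = (2 * r) ^ n := by
  rw [volume_cube c hr, ENNReal.toReal_ofReal (by positivity)]

lemma int_abs {n : ℕ} {b : En n → ℝ} (hb : Continuous b) (c : En n) {r : ℝ} (hr : 0 < r) (m : ℝ) :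
    IntegrableOn (fun x => |b x - m|) (cube c r) :=
  integrableOn (by fun_prop) c hr

lemma avg_sub {n : ℕ} {b : En n → ℝ} (hb : Continuous b) (c : En n) {r : ℝ} (hr : 0 < r) (m : ℝ) :
    |cubeAvg b c r - m| ≤ (∫ x in cube c r, |b x - m|) / (2 * r) ^ n := by
  have hp : 0 < (2 * r) ^ n := by positivity
  have hfin : volume (cube c r) ≠ ∞ := by rw [volume_cube c hr]; exact ENNReal.ofReal_ne_top
  have h1 : cubeAvg b c r - m = (∫ x in cube c r, (b x - m)) / (2 * r) ^ n := by
    rw [integral_sub (integrableOn hb c hr) (integrableOn continuous_const c hr)]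
    simp only [cubeAvg, vol_real c hr, setIntegral_const, Measure.real, smul_eq_mul]
    field_simp
  rw [h1, abs_div, abs_of_pos hp]
  gcongr
  exact abs_integral_le_integral_abs

lemma avg_sub_le {n : ℕ} {b : En n → ℝ} (hb : Continuous b) (c : En n) {r : ℝ} (hr : 0 < r)
    (m ε : ℝ) (h : ∀ y ∈ cube c r, |b y - m| ≤ ε) : |cubeAvg b c r - m| ≤ ε := by
  have hp : 0 < (2 * r) ^ n := by positivity
  refine (avg_sub hb c hr m).trans ?_
  rw [div_le_iff₀ hp]
  calc ∫ x in cube c r, |b x - m| ≤ ∫ x in cube c r, ε :=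
        setIntegral_mono_on (int_abs hb c hr m) (integrableOn continuous_const c hr)
          (isOpen_cube c hr).measurableSet h
    _ = ε * (2 * r) ^ n := by
        simp only [setIntegral_const, Measure.real, vol_real c hr, smul_eq_mul]; ring

lemma lip_le {n : ℕ} {α : ℝ} (hα : 0 < α) {b : En n → ℝ} (hL : lipSeminorm α b ≠ ∞) (x y : En n) :
    |b x - b y| ≤ (lipSeminorm α b).toReal * ‖x - y‖ ^ α := by
  rcases eq_or_ne x y with rfl | hxy
  · simp [Real.zero_rpow hα.ne']
  have h : (‖b x - b y‖₊ : ℝ≥0∞) / edist x y ^ α ≤ lipSeminorm α b := by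
    unfold lipSeminorm
    exact le_iSup_of_le x (le_iSup_of_le y (le_iSup_of_le hxy le_rfl))
  have hd : 0 < ‖x - y‖ := norm_pos_iff.2 (sub_ne_zero.2 hxy)
  have := ENNReal.toReal_mono hL h
  rw [ENNReal.toReal_div, ← ENNReal.toReal_rpow, edist_dist, ENNReal.toReal_ofReal dist_nonneg,
    dist_eq_norm, div_le_iff₀ (by positivity)] at this
  simpa using this

lemma vol_rpow {n : ℕ} (hn : n ≠ 0) (α : ℝ) (c : En n) {r : ℝ} (hr : 0 < r) :
    volume (cube c r) ^ (-(1 + α / (n : ℝ))) = ENNReal.ofReal (((2 * r) ^ n * (2 * r) ^ α)⁻¹) := by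
  have hn' : (n : ℝ) ≠ 0 := by exact_mod_cast hn
  rw [volume_cube c hr, ENNReal.ofReal_rpow_of_pos (by positivity)]
  congr 1
  rw [← Real.rpow_natCast, ← Real.rpow_mul (by positivity), ← Real.rpow_add (by positivity),
    ← Real.rpow_neg (by positivity)]
  congr 1
  field_simp

lemma lint_eq {n : ℕ} {b : En n → ℝ} (hb : Continuous b) (c : En n) {r : ℝ} (hr : 0 < r) (m : ℝ) :
    ∫⁻ x in cube c r, (‖b x - m‖₊ : ℝ≥0∞) = ENNReal.ofReal (∫ x in cube c r, |b x - m|) := by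
  rw [ofReal_integral_eq_lintegral_ofReal (int_abs hb c hr m) (by filter_upwards with x; simp)]
  refine lintegral_congr fun x => ?_
  rw [← Real.norm_eq_abs, ofReal_norm_eq_enorm]; rfl

lemma upper {n : ℕ} (hn : n ≠ 0) {α : ℝ} (hα : 0 < α) {b : En n → ℝ} (hb : Continuous b) :
    lipAvgNorm α b ≤ ENNReal.ofReal ((Real.sqrt n) ^ α) * lipSeminorm α b := by
  have hn0 : (0 : ℝ) < n := by exact_mod_cast Nat.pos_of_ne_zero hn
  by_cases hL : lipSeminorm α b = ∞
  · rw [hL, ENNReal.mul_top]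
    · exact le_top
    · rw [Ne, ENNReal.ofReal_eq_zero, not_le]; positivity
  set L := (lipSeminorm α b).toReal with hLdef
  have hL0 : 0 ≤ L := ENNReal.toReal_nonneg
  rw [← ENNReal.ofReal_toReal hL, ← hLdef, ← ENNReal.ofReal_mul (by positivity)]
  unfold lipAvgNorm
  refine iSup_le fun c => iSup_le fun r => iSup_le fun hr => ?_
  rw [vol_rpow hn α c hr, lint_eq hb c hr, ← ENNReal.ofReal_mul (by positivity)]
  refine ENNReal.ofReal_le_ofReal ?_
  rw [inv_mul_le_iff₀ (by positivity)]
  have key : ∀ x ∈ cube c r, |b x - cubeAvg b c r| ≤ L * (Real.sqrt n * (2 * r)) ^ α := by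
    intro x hx
    rw [abs_sub_comm]
    refine avg_sub_le hb c hr _ _ fun y hy => (lip_le hα hL y x).trans ?_
    gcongr
    refine norm_sub_le (by positivity) fun i => ?_
    have h1 := abs_lt.1 (hx i)
    have h2 := abs_lt.1 (hy i)
    rw [abs_le]; constructor <;> linarith
  calc ∫ x in cube c r, |b x - cubeAvg b c r|
      ≤ ∫ x in cube c r, L * (Real.sqrt n * (2 * r)) ^ α :=
        setIntegral_mono_on (int_abs hb c hr _) (integrableOn continuous_const c hr)
          (isOpen_cube c hr).measurableSet key
    _ = _ := by
        simp only [setIntegral_const, Measure.real, vol_real c hr, smul_eq_mul]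
        rw [Real.mul_rpow (by positivity) (by positivity)]; ring

lemma osc_le {n : ℕ} (hn : n ≠ 0) {α : ℝ} {b : En n → ℝ} (hb : Continuous b)
    (hA : lipAvgNorm α b ≠ ∞) (c : En n) {r : ℝ} (hr : 0 < r) :
    ∫ x in cube c r, |b x - cubeAvg b c r| ≤
      (lipAvgNorm α b).toReal * ((2 * r) ^ n * (2 * r) ^ α) := by
  have h : volume (cube c r) ^ (-(1 + α / (n : ℝ))) *
      ∫⁻ x in cube c r, (‖b x - cubeAvg b c r‖₊ : ℝ≥0∞) ≤ lipAvgNorm α b := by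
    unfold lipAvgNorm
    exact le_iSup_of_le c (le_iSup_of_le r (le_iSup_of_le hr le_rfl))
  rw [vol_rpow hn α c hr, lint_eq hb c hr, ← ENNReal.ofReal_mul (by positivity)] at h
  have := (ENNReal.ofReal_le_iff_le_toReal hA).1 h
  rw [inv_mul_le_iff₀ (by positivity)] at this
  linarith

lemma step {n : ℕ} (hn : n ≠ 0) {α : ℝ} {b : En n → ℝ} (hb : Continuous b)
    (hA : lipAvgNorm α b ≠ ∞) (c c' : En n) {r : ℝ} (hr : 0 < r)
    (hsub : cube c' r ⊆ cube c (2 * r)) :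
    |cubeAvg b c' r - cubeAvg b c (2 * r)| ≤ 2 ^ n * (lipAvgNorm α b).toReal * (4 * r) ^ α := by
  refine (avg_sub hb c' hr _).trans ?_
  have h2r : 0 < 2 * r := by positivity
  rw [div_le_iff₀ (by positivity)]
  calc ∫ x in cube c' r, |b x - cubeAvg b c (2 * r)|
      ≤ ∫ x in cube c (2 * r), |b x - cubeAvg b c (2 * r)| :=
        setIntegral_mono_set (int_abs hb c h2r _) (by filter_upwards with x; simp)
          hsub.eventuallyLE
    _ ≤ _ := osc_le hn hb hA c h2r
    _ = _ := by
      rw [show 2 * (2 * r) = 4 * r by ring, show (4 * r) ^ n = 2 ^ n * (2 * r) ^ n by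
        rw [← mul_pow]; congr 1; ring]
      ring

lemma avg_tendsto {n : ℕ} {b : En n → ℝ} (hb : Continuous b) (c : En n) {s : ℝ} (hs : 0 < s) :
    Filter.Tendsto (fun k : ℕ => cubeAvg b c (s * (1 / 2) ^ k)) Filter.atTop (nhds (b c)) := by
  rw [Metric.tendsto_atTop]
  intro ε hε
  obtain ⟨δ, hδ, h⟩ := Metric.continuous_iff.1 hb c (ε / 2) (by positivity)
  have hlim : Filter.Tendsto (fun k : ℕ => Real.sqrt n * (s * (1 / 2 : ℝ) ^ k)) Filter.atTop
      (nhds 0) := by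
    have := ((tendsto_pow_atTop_nhds_zero_of_lt_one (r := (1 / 2 : ℝ)) (by norm_num)
      (by norm_num)).const_mul s).const_mul (Real.sqrt n)
    simpa using this
  obtain ⟨N, hN⟩ := Filter.eventually_atTop.1 (hlim.eventually (gt_mem_nhds hδ))
  refine ⟨N, fun k hk => ?_⟩
  have hp : 0 < s * (1 / 2 : ℝ) ^ k := by positivity
  rw [Real.dist_eq]
  refine (avg_sub_le hb c hp (b c) (ε / 2) fun y hy => ?_).trans_lt (by linarith)
  have := h y (by
    rw [dist_eq_norm]
    exact (norm_sub_le hp fun i => (hy i).le).trans_lt (hN k hk))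
  rw [Real.dist_eq] at this
  exact this.le

lemma center {n : ℕ} (hn : n ≠ 0) {α : ℝ} (hα : 0 < α) {b : En n → ℝ} (hb : Continuous b)
    (hA : lipAvgNorm α b ≠ ∞) (c : En n) {s : ℝ} (hs : 0 < s) :
    |cubeAvg b c s - b c| ≤
      2 ^ n * (lipAvgNorm α b).toReal * (2 * s) ^ α / (1 - (1 / 2 : ℝ) ^ α) := by
  have hρ : (1 / 2 : ℝ) ^ α < 1 := Real.rpow_lt_one (by norm_num) (by norm_num) hα
  have := dist_le_of_le_geometric_of_tendsto₀ ((1 / 2 : ℝ) ^ α)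
    (2 ^ n * (lipAvgNorm α b).toReal * (2 * s) ^ α) hρ
    (f := fun k : ℕ => cubeAvg b c (s * (1 / 2) ^ k)) (a := b c) ?_ (avg_tendsto hb c hs)
  · simpa [Real.dist_eq] using this
  intro k
  have hp : 0 < s * (1 / 2 : ℝ) ^ (k + 1) := by positivity
  have hst := step hn hb hA c c hp (fun y hy i => (hy i).trans (by linarith))
  rw [show 2 * (s * (1 / 2 : ℝ) ^ (k + 1)) = s * (1 / 2) ^ k by rw [pow_succ]; ring,
    show 4 * (s * (1 / 2 : ℝ) ^ (k + 1)) = (2 * s) * (1 / 2) ^ k by rw [pow_succ]; ring,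
    Real.mul_rpow (by positivity) (by positivity)] at hst
  rw [dist_comm, Real.dist_eq]
  refine hst.trans (le_of_eq ?_)
  have e : (((1 / 2 : ℝ) ^ k) ^ α) = ((1 / 2 : ℝ) ^ α) ^ k := by
    rw [← Real.rpow_natCast, ← Real.rpow_mul (by norm_num), mul_comm (k : ℝ) α,
      Real.rpow_mul (by norm_num), Real.rpow_natCast]
  rw [e]
  ring

lemma lower {n : ℕ} (hn : n ≠ 0) {α : ℝ} (hα : 0 < α) {b : En n → ℝ} (hb : Continuous b) :
    ENNReal.ofReal ((3 * (2 ^ n / (1 - (1 / 2 : ℝ) ^ α)) * 4 ^ α)⁻¹) * lipSeminorm α b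
      ≤ lipAvgNorm α b := by
  by_cases hA : lipAvgNorm α b = ∞
  · rw [hA]; exact le_top
  have hρ : (1 / 2 : ℝ) ^ α < 1 := Real.rpow_lt_one (by norm_num) (by norm_num) hα
  have hρ0 : 0 < (1 / 2 : ℝ) ^ α := by positivity
  have hρ1 : 0 < 1 - (1 / 2 : ℝ) ^ α := by linarith
  set K := 2 ^ n / (1 - (1 / 2 : ℝ) ^ α) with hK
  have hK0 : 0 < K := by positivity
  have hK1 : 2 ^ n ≤ K := by
    rw [hK, le_div_iff₀ hρ1]
    have : (0 : ℝ) < 2 ^ n := by positivity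
    nlinarith
  set a := (lipAvgNorm α b).toReal with ha
  have ha0 : 0 ≤ a := ENNReal.toReal_nonneg
  have hC : 0 < 3 * K * 4 ^ α := by positivity
  rw [ENNReal.ofReal_inv_of_pos hC, mul_comm, ← div_eq_mul_inv]
  refine ENNReal.div_le_of_le_mul ?_
  rw [← ENNReal.ofReal_toReal hA, ← ha, ← ENNReal.ofReal_mul ha0]
  unfold lipSeminorm
  refine iSup_le fun x => iSup_le fun y => iSup_le fun hxy => ?_
  have hd : 0 < ‖x - y‖ := norm_pos_iff.2 (sub_ne_zero.2 hxy)
  refine ENNReal.div_le_of_le_mul ?_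
  rw [edist_dist, dist_eq_norm, ENNReal.ofReal_rpow_of_pos hd, ← ENNReal.ofReal_mul (by positivity)]
  have e : (‖b x - b y‖₊ : ℝ≥0∞) = ENNReal.ofReal |b x - b y| := by
    rw [← Real.norm_eq_abs, ofReal_norm_eq_enorm]; rfl
  rw [e]
  refine ENNReal.ofReal_le_ofReal ?_
  set d := ‖x - y‖ with hdd
  have h1 := center hn hα hb hA x (s := 2 * d) (by positivity)
  have h2 := center hn hα hb hA y hd
  have h3 := step hn hb hA x y hd (by
    intro z hz i
    have h4 : |y i - x i| ≤ d := by
      have := PiLp.norm_apply_le (x - y) i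
      rwa [PiLp.sub_apply, Real.norm_eq_abs, abs_sub_comm] at this
    have h5 := abs_sub_le (z i) (y i) (x i)
    have h6 := hz i
    linarith)
  rw [← ha] at h1 h2 h3
  rw [show 2 * (2 * d) = 4 * d by ring] at h1
  have hm : (2 * d) ^ α ≤ (4 * d) ^ α := by gcongr; norm_num
  have g1 : |cubeAvg b x (2 * d) - b x| ≤ K * a * (4 * d) ^ α :=
    h1.trans (le_of_eq (by rw [hK]; ring))
  have g2 : |cubeAvg b y d - b y| ≤ K * a * (4 * d) ^ α := by
    refine h2.trans ((le_of_eq (by rw [hK]; ring : _ = K * a * (2 * d) ^ α)).trans ?_)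
    gcongr
  have g3 : |cubeAvg b y d - cubeAvg b x (2 * d)| ≤ K * a * (4 * d) ^ α := by
    refine h3.trans ?_
    gcongr
  have fin : |b x - b y| ≤ 3 * (K * a * (4 * d) ^ α) := by
    rw [abs_le] at *
    constructor <;> linarith [g1.1, g1.2, g2.1, g2.2, g3.1, g3.2]
  refine fin.trans (le_of_eq ?_)
  rw [Real.mul_rpow (by positivity) (by positivity)]
  ring

end LipAux

/-- For `0 < α < 1` and continuous `b`, the Lipschitz seminorm `‖b‖_{Lip_α}` is
comparable with `sup_Q |Q|^{-(1+α/n)} ∫_Q |b - b_Q|`, with constants depending only on `n, α`. -/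
theorem lipSeminorm_equiv_lipAvgNorm (n : ℕ) (α : ℝ) (hα : 0 < α) (hα1 : α < 1) :
    ∃ c₁ c₂ : ℝ, 0 < c₁ ∧ 0 < c₂ ∧
      ∀ b : En n → ℝ, Continuous b →
        ENNReal.ofReal c₁ * lipSeminorm α b ≤ lipAvgNorm α b ∧
        lipAvgNorm α b ≤ ENNReal.ofReal c₂ * lipSeminorm α b := by
  rcases eq_or_ne n 0 with rfl | hn
  · refine ⟨1, 1, one_pos, one_pos, fun b hb => ?_⟩
    have h1 : lipSeminorm α b = 0 := by
      unfold lipSeminorm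
      simp only [ENNReal.iSup_eq_zero]
      intro x y hxy
      exact absurd (Subsingleton.elim x y) hxy
    have h2 : lipAvgNorm α b = 0 := by
      unfold lipAvgNorm
      simp only [ENNReal.iSup_eq_zero]
      intro c r hr
      have : ∀ x, b x - cubeAvg b c r = 0 := by
        intro x
        have := LipAux.avg_sub_le hb c hr (b x) 0 fun y _ => by simp [Subsingleton.elim y x]
        have := abs_eq_zero.1 (le_antisymm this (abs_nonneg _))
        linarith
      simp [this]
    simp [h1, h2]
  · have hρ : (1 / 2 : ℝ) ^ α < 1 := Real.rpow_lt_one (by norm_num) (by norm_num) hα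
    have hρ1 : 0 < 1 - (1 / 2 : ℝ) ^ α := by linarith
    have hn0 : (0 : ℝ) < n := by exact_mod_cast Nat.pos_of_ne_zero hn
    exact ⟨(3 * (2 ^ n / (1 - (1 / 2 : ℝ) ^ α)) * 4 ^ α)⁻¹, (Real.sqrt n) ^ α, by positivity,
      by positivity, fun b hb => ⟨LipAux.lower hn hα hb, LipAux.upper hn hα hb⟩⟩
end
end

section
/- Let 0 < α < 1 and let b be a locally integrable function on ℝⁿ. Then there exist positive constants c₁, c₂ depending only on n and α such that c₁ · sup_Q |Q|^{−(1+α/n)} ∫_Q |b(x) − b_Q| dx ≤ sup_Q |Q|^{−α/n} ess sup_{x ∈ Q} |b(x) − b_Q| ≤ c₂ · sup_Q |Q|^{−(1+α/n)} ∫_Q |b(x) − b_Q| dx, where all suprema are over all cubes Q ⊂ ℝⁿ (either side may be infinite, in which case both are). -/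
open MeasureTheory ENNReal

noncomputable section

/-- `sup_Q |Q|^{-α/n} esssup_{x ∈ Q} |b x - b_Q|`. -/
def lipInftyNorm {n : ℕ} (α : ℝ) (b : En n → ℝ) : ℝ≥0∞ :=
  ⨆ (c : En n) (r : ℝ) (_ : 0 < r),
    volume (cube c r) ^ (-(α / (n : ℝ))) *
      essSup (fun x => (‖b x - cubeAvg b c r‖₊ : ℝ≥0∞)) (volume.restrict (cube c r))

open Filter Topology in
lemma cube_eq {n : ℕ} (c : En n) {r : ℝ} (hr : 0 < r) :
    cube c r = (WithLp.ofLp : En n → (Fin n → ℝ)) ⁻¹' Metric.ball (WithLp.ofLp c) r := by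
  ext y
  simp only [cube, Set.mem_preimage, Metric.mem_ball, dist_pi_lt_iff hr, Real.dist_eq]
  rfl

lemma measurableSet_cube {n : ℕ} (c : En n) {r : ℝ} (hr : 0 < r) : MeasurableSet (cube c r) := by
  rw [cube_eq c hr]
  exact (PiLp.volume_preserving_ofLp (Fin n)).measurable measurableSet_ball

lemma volume_cube {n : ℕ} (c : En n) {r : ℝ} (hr : 0 < r) :
    volume (cube c r) = ENNReal.ofReal ((2 * r) ^ n) := by
  rw [cube_eq c hr, (PiLp.volume_preserving_ofLp (Fin n)).measure_preimage
    measurableSet_ball.nullMeasurableSet, Real.volume_pi_ball _ hr]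
  simp

lemma ofLp_emb (n : ℕ) : MeasurableEmbedding (WithLp.ofLp : En n → (Fin n → ℝ)) :=
  (MeasurableEquiv.toLp 2 (Fin n → ℝ)).symm.measurableEmbedding

lemma cubeAvg_eq {n : ℕ} (b : En n → ℝ) (c : En n) {r : ℝ} (hr : 0 < r) :
    cubeAvg b c r = ⨍ y in Metric.closedBall (WithLp.ofLp c) r, b (WithLp.toLp 2 y) := by
  have h1 : ∫ x in cube c r, b x
      = ∫ y in Metric.closedBall (WithLp.ofLp c) r, b (WithLp.toLp 2 y) := by
    have h2 : (Metric.closedBall (WithLp.ofLp c) r : Set (Fin n → ℝ))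
        =ᵐ[volume] Metric.ball (WithLp.ofLp c) r := by
      refine (ae_eq_of_subset_of_measure_ge Metric.ball_subset_closedBall ?_
        measurableSet_ball.nullMeasurableSet ?_).symm
      · rw [Real.volume_pi_ball _ hr, Real.volume_pi_closedBall _ hr.le]
      · rw [Real.volume_pi_closedBall _ hr.le]; exact ENNReal.ofReal_ne_top
    rw [setIntegral_congr_set h2, cube_eq c hr,
      ← (PiLp.volume_preserving_ofLp (Fin n)).setIntegral_preimage_emb (ofLp_emb n)]
  rw [cubeAvg, h1, setAverage_eq, volume_cube c hr, measureReal_def,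
    Real.volume_pi_closedBall _ hr.le, Fintype.card_fin, smul_eq_mul, div_eq_inv_mul]

lemma integrableOn_cube {n : ℕ} {b : En n → ℝ} (hb : LocallyIntegrable b volume) (c : En n)
    {r : ℝ} (hr : 0 < r) : IntegrableOn b (cube c r) := by
  have hK : IsCompact ((EuclideanSpace.equiv (Fin n) ℝ).toHomeomorph ⁻¹'
      Metric.closedBall (WithLp.ofLp c) r) :=
    (Homeomorph.isCompact_preimage _).2 (isCompact_closedBall _ _)
  refine (hb.integrableOn_isCompact hK).mono_set ?_
  rw [cube_eq c hr]
  intro y hy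
  exact Metric.ball_subset_closedBall hy

open Filter Topology in
lemma ae_tendsto_cubeAvg {n : ℕ} {b : En n → ℝ} (hb : LocallyIntegrable b volume) :
    ∀ᵐ x : En n, ∀ (w : ℕ → En n) (δ : ℕ → ℝ), (∀ k, 0 < δ k) → Tendsto δ atTop (𝓝 0) →
      (∀ k, x ∈ cube (w k) (δ k)) →
      Tendsto (fun k => cubeAvg b (w k) (δ k)) atTop (𝓝 (b x)) := by
  have hg : LocallyIntegrable (fun y : Fin n → ℝ => b (WithLp.toLp 2 y)) volume := by
    have := (locallyIntegrable_map_homeomorph (EuclideanSpace.equiv (Fin n) ℝ).symm.toHomeomorph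
      (f := b) (μ := volume)).1 (by
        have h := (PiLp.volume_preserving_toLp (Fin n)).map_eq
        have h' : Measure.map (EuclideanSpace.equiv (Fin n) ℝ).symm.toHomeomorph volume
          = (volume : Measure (En n)) := h
        rw [h']; exact hb)
    exact this
  have h := IsUnifLocDoublingMeasure.ae_tendsto_average volume hg 1
  have h2 := (PiLp.volume_preserving_ofLp (Fin n)).quasiMeasurePreserving.ae h
  filter_upwards [h2] with x hx w δ hδ hδ0 hxm
  have h3 := hx (ι := ℕ) (l := atTop) (fun k => WithLp.ofLp (w k)) δ
    (tendsto_nhdsWithin_iff.2 ⟨hδ0, Eventually.of_forall hδ⟩)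
    (Eventually.of_forall fun k => by
      have := hxm k
      rw [cube_eq _ (hδ k)] at this
      rw [one_mul]
      exact Metric.ball_subset_closedBall this)
  refine h3.congr fun k => ?_
  rw [cubeAvg_eq b _ (hδ k)]

lemma cubeAvg_diff {n : ℕ} {b : En n → ℝ} (hb : LocallyIntegrable b volume) {c c' : En n}
    {r : ℝ} (hr : 0 < r) (hsub : cube c' (r / 2) ⊆ cube c r) :
    dist (cubeAvg b c r) (cubeAvg b c' (r / 2)) ≤
      2 ^ n * (((2 * r) ^ n)⁻¹ * ∫ x in cube c r, |b x - cubeAvg b c r|) := by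
  have hr2 : 0 < r / 2 := by positivity
  set a := cubeAvg b c r with ha
  have hi := integrableOn_cube hb c hr
  have hi' := integrableOn_cube hb c' hr2
  have hv : volume (cube c r) ≠ ⊤ := by rw [volume_cube c hr]; exact ENNReal.ofReal_ne_top
  have hv' : volume (cube c' (r/2)) ≠ ⊤ := by
    rw [volume_cube c' hr2]; exact ENNReal.ofReal_ne_top
  have hca : IntegrableOn (fun _ : En n => a) (cube c r) := integrableOn_const hv
  have hca' : IntegrableOn (fun _ : En n => a) (cube c' (r/2)) := integrableOn_const hv'
  have hrn : (0:ℝ) < r ^ n := by positivity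
  have e1 : cubeAvg b c' (r/2) - a = (r ^ n)⁻¹ * ∫ x in cube c' (r/2), (b x - a) := by
    rw [integral_sub hi' hca', setIntegral_const, cubeAvg, measureReal_def, volume_cube c' hr2,
      show 2 * (r/2) = r by ring, ENNReal.toReal_ofReal hrn.le, smul_eq_mul]
    field_simp
  rw [dist_comm, Real.dist_eq, e1, abs_mul, abs_of_pos (inv_pos.2 hrn)]
  have e2 : |∫ x in cube c' (r/2), (b x - a)| ≤ ∫ x in cube c r, |b x - a| := by
    refine (abs_integral_le_integral_abs).trans ?_
    exact setIntegral_mono_set (hi.sub hca).abs (Filter.Eventually.of_forall fun x => abs_nonneg _)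
      (LE.le.eventuallyLE hsub)
  have e3 : (2:ℝ) ^ n * (((2 * r) ^ n)⁻¹ * ∫ x in cube c r, |b x - a|)
      = (r ^ n)⁻¹ * ∫ x in cube c r, |b x - a| := by
    rw [mul_pow]; field_simp
  rw [e3]
  gcongr

lemma int_bound {n : ℕ} (hn : n ≠ 0) {α : ℝ} {b : En n → ℝ}
    (hb : LocallyIntegrable b volume) (hA : lipAvgNorm α b ≠ ⊤) (c : En n) {r : ℝ} (hr : 0 < r) :
    ((2 * r) ^ n)⁻¹ * ∫ x in cube c r, |b x - cubeAvg b c r|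
      ≤ (lipAvgNorm α b).toReal * (2 * r) ^ α := by
  have hs : (0:ℝ) < 2 * r := by positivity
  have h : volume (cube c r) ^ (-(1 + α / (n : ℝ))) *
      ∫⁻ x in cube c r, (‖b x - cubeAvg b c r‖₊ : ℝ≥0∞) ≤ lipAvgNorm α b :=
    le_iSup_of_le c (le_iSup_of_le r (le_iSup_of_le hr le_rfl))
  have hv : volume (cube c r) ≠ ⊤ := by rw [volume_cube c hr]; exact ENNReal.ofReal_ne_top
  have hi : IntegrableOn (fun x => b x - cubeAvg b c r) (cube c r) :=
    (integrableOn_cube hb c hr).sub (integrableOn_const hv)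
  have h2 := ENNReal.toReal_mono hA h
  have e : (∫⁻ x in cube c r, (‖b x - cubeAvg b c r‖₊ : ℝ≥0∞)).toReal
      = ∫ x in cube c r, |b x - cubeAvg b c r| :=
    (integral_norm_eq_lintegral_enorm hi.aestronglyMeasurable).symm
  rw [ENNReal.toReal_mul, e, volume_cube c hr, ← ENNReal.toReal_rpow,
    ENNReal.toReal_ofReal (by positivity), ← Real.rpow_natCast, ← Real.rpow_mul hs.le] at h2
  have hn' : (n:ℝ) ≠ 0 := by exact_mod_cast hn
  have e4 : (n:ℝ) * (-(1 + α / n)) = -n + -α := by field_simp; ring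
  rw [e4, Real.rpow_add hs, Real.rpow_neg hs.le, Real.rpow_neg hs.le, Real.rpow_natCast] at h2
  have hp : 0 < (2 * r) ^ α := Real.rpow_pos_of_pos hs α
  calc _ = (((2 * r) ^ n)⁻¹ * ((2 * r) ^ α)⁻¹ * ∫ x in cube c r, |b x - cubeAvg b c r|)
      * (2 * r) ^ α := by field_simp
    _ ≤ _ := by gcongr

open Filter Topology in
lemma ae_bound {n : ℕ} (hn : n ≠ 0) {α : ℝ} (hα : 0 < α) {b : En n → ℝ}
    (hb : LocallyIntegrable b volume) (hA : lipAvgNorm α b ≠ ⊤) (c : En n) {r : ℝ} (hr : 0 < r) :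
    ∀ᵐ x ∂(volume.restrict (cube c r)), |b x - cubeAvg b c r| ≤
      2 ^ n / (1 - (1/2) ^ α) * (lipAvgNorm α b).toReal * (2 * r) ^ α := by
  rw [ae_restrict_iff' (measurableSet_cube c hr)]
  filter_upwards [ae_tendsto_cubeAvg hb] with x hx hxc
  set w : ℕ → En n := fun k => x + ((1/2:ℝ) ^ k) • (c - x) with hw
  set δ : ℕ → ℝ := fun k => (1/2:ℝ) ^ k * r with hδ
  have hδp : ∀ k, 0 < δ k := fun k => by positivity
  have hwi : ∀ k i, w k i = x i + (1/2:ℝ) ^ k * (c i - x i) := fun k i => by simp [hw]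
  have hδ0 : Tendsto δ atTop (𝓝 0) := by
    have := (tendsto_pow_atTop_nhds_zero_of_lt_one (r := (1/2:ℝ)) (by norm_num)
      (by norm_num)).mul_const r
    simpa [hδ] using this
  have hmem : ∀ k, x ∈ cube (w k) (δ k) := by
    intro k i
    have h1 : x i - w k i = (1/2:ℝ) ^ k * (x i - c i) := by rw [hwi]; ring
    rw [h1, abs_mul, abs_of_pos (by positivity)]
    exact mul_lt_mul_of_pos_left (hxc i) (by positivity)
  have hδs : ∀ k, δ (k+1) = δ k / 2 := fun k => by simp only [hδ]; ring
  have hsub : ∀ k, cube (w (k+1)) (δ k / 2) ⊆ cube (w k) (δ k) := by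
    intro k y hy i
    have h1 := hy i
    have h2 : y i - w k i = (y i - w (k+1) i) + (1/2:ℝ) ^ k / 2 * (x i - c i) := by
      rw [hwi, hwi]; ring
    have h3 : |(1/2:ℝ) ^ k / 2 * (x i - c i)| < δ k / 2 := by
      rw [abs_mul, abs_of_pos (by positivity)]
      have := mul_lt_mul_of_pos_left (hxc i) (show (0:ℝ) < (1/2:ℝ) ^ k / 2 by positivity)
      simp only [hδ]; linarith
    rw [h2]
    have := abs_add_le (y i - w (k+1) i) ((1/2:ℝ) ^ k / 2 * (x i - c i))
    linarith
  have hq : ((1/2:ℝ)) ^ α < 1 := Real.rpow_lt_one (by norm_num) (by norm_num) hα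
  have hstep : ∀ k, dist (cubeAvg b (w k) (δ k)) (cubeAvg b (w (k+1)) (δ (k+1))) ≤
      (2 ^ n * ((lipAvgNorm α b).toReal * (2 * r) ^ α)) * ((1/2:ℝ) ^ α) ^ k := by
    intro k
    rw [hδs]
    refine (cubeAvg_diff hb (hδp k) (hsub k)).trans ?_
    have h1 := int_bound hn hb hA (w k) (hδp k)
    have h2 : (2 * δ k) ^ α = (2 * r) ^ α * ((1/2:ℝ) ^ α) ^ k := by
      rw [show 2 * δ k = (2 * r) * (1/2:ℝ) ^ k by simp only [hδ]; ring,
        Real.mul_rpow (by positivity) (by positivity), ← Real.rpow_natCast, ← Real.rpow_natCast,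
        ← Real.rpow_mul (by norm_num), ← Real.rpow_mul (by norm_num), mul_comm α]
    rw [h2] at h1
    calc _ ≤ 2 ^ n * ((lipAvgNorm α b).toReal * ((2 * r) ^ α * ((1/2:ℝ) ^ α) ^ k)) := by gcongr
      _ = _ := by ring
  have hfin := dist_le_of_le_geometric_of_tendsto₀ _ _ hq hstep (hx w δ hδp hδ0 hmem)
  have hw0 : w 0 = c := by simp [hw]
  have hδ00 : δ 0 = r := by simp [hδ]
  rw [hw0, hδ00, dist_comm, Real.dist_eq] at hfin
  refine hfin.trans (le_of_eq ?_)
  ring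

/-- For `0 < α < 1` and locally integrable `b`, the quantities
`sup_Q |Q|^{-(1+α/n)} ∫_Q |b - b_Q|` and `sup_Q |Q|^{-α/n} esssup_{x ∈ Q} |b x - b_Q|`
are comparable, with constants depending only on `n, α`. -/
theorem lipAvgNorm_equiv_lipInftyNorm (n : ℕ) (α : ℝ) (hα : 0 < α) (hα1 : α < 1) :
    ∃ c₁ c₂ : ℝ, 0 < c₁ ∧ 0 < c₂ ∧
      ∀ b : En n → ℝ, LocallyIntegrable b volume →
        ENNReal.ofReal c₁ * lipAvgNorm α b ≤ lipInftyNorm α b ∧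
        lipInftyNorm α b ≤ ENNReal.ofReal c₂ * lipAvgNorm α b := by
  have hq : ((1/2:ℝ)) ^ α < 1 := Real.rpow_lt_one (by norm_num) (by norm_num) hα
  have hC : (0:ℝ) < 2 ^ n / (1 - (1/2) ^ α) := div_pos (by positivity) (by linarith)
  refine ⟨1, 2 ^ n / (1 - (1/2) ^ α), one_pos, hC, fun b hb => ⟨?_, ?_⟩⟩
  · rw [ENNReal.ofReal_one, one_mul]
    refine iSup_le fun c => iSup_le fun r => iSup_le fun hr => ?_
    refine le_trans ?_ (le_iSup_of_le c (le_iSup_of_le r (le_iSup_of_le hr le_rfl)))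
    have hv0 : volume (cube c r) ≠ 0 := by
      rw [volume_cube c hr]
      simp only [ne_eq, ENNReal.ofReal_eq_zero, not_le]
      positivity
    have hv : volume (cube c r) ≠ ⊤ := by rw [volume_cube c hr]; exact ENNReal.ofReal_ne_top
    have h1 : ∫⁻ x in cube c r, (‖b x - cubeAvg b c r‖₊ : ℝ≥0∞) ≤
        essSup (fun x => (‖b x - cubeAvg b c r‖₊ : ℝ≥0∞)) (volume.restrict (cube c r))
          * volume (cube c r) := by
      refine (lintegral_mono_ae (ENNReal.ae_le_essSup _)).trans ?_
      rw [lintegral_const, Measure.restrict_apply_univ]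
    calc _ ≤ volume (cube c r) ^ (-(1 + α / (n : ℝ))) * (essSup (fun x =>
          (‖b x - cubeAvg b c r‖₊ : ℝ≥0∞)) (volume.restrict (cube c r))
          * volume (cube c r)) := by gcongr
      _ = (volume (cube c r) ^ (-(1 + α / (n : ℝ))) * volume (cube c r) ^ (1:ℝ)) *
          essSup (fun x => (‖b x - cubeAvg b c r‖₊ : ℝ≥0∞)) (volume.restrict (cube c r)) := by
        rw [ENNReal.rpow_one]; ring
      _ = _ := by
        rw [← ENNReal.rpow_add _ _ hv0 hv]
        congr 2
        ring
  · rcases eq_or_ne n 0 with rfl | hn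
    · refine le_trans (le_of_eq ?_) zero_le
      simp only [lipInftyNorm, ENNReal.iSup_eq_zero]
      intro c r hr
      have h0 : ∀ x, b x - cubeAvg b c r = 0 := by
        intro x
        have hbx : b = fun _ => b x := funext fun y => congrArg b (Subsingleton.elim y x)
        have : cubeAvg b c r = b x := by
          rw [hbx, cubeAvg, setIntegral_const, measureReal_def, volume_cube c hr]
          simp
        rw [this, sub_self]
      simp only [h0, nnnorm_zero, ENNReal.coe_zero]
      rw [show (fun _ : En 0 => (0:ℝ≥0∞)) = fun _ => ⊥ from rfl, essSup_const_bot]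
      simp
    by_cases hA : lipAvgNorm α b = ⊤
    · rw [hA, ENNReal.mul_top (by simpa using hC)]
      exact le_top
    refine iSup_le fun c => iSup_le fun r => iSup_le fun hr => ?_
    have hs : (0:ℝ) < 2 * r := by positivity
    have hn' : (n:ℝ) ≠ 0 := by exact_mod_cast hn
    have hp : 0 < (2 * r) ^ α := Real.rpow_pos_of_pos hs α
    have h1 : essSup (fun x => (‖b x - cubeAvg b c r‖₊ : ℝ≥0∞)) (volume.restrict (cube c r))
        ≤ ENNReal.ofReal (2 ^ n / (1 - (1/2) ^ α) * (lipAvgNorm α b).toReal * (2 * r) ^ α) := by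
      refine essSup_le_of_ae_le _ ?_
      filter_upwards [ae_bound hn hα hb hA c hr] with x hx
      have h2 : (‖b x - cubeAvg b c r‖₊ : ℝ≥0∞) = ENNReal.ofReal |b x - cubeAvg b c r| :=
        Real.enorm_eq_ofReal_abs _
      rw [h2]
      exact ENNReal.ofReal_le_ofReal hx
    have h3 : volume (cube c r) ^ (-(α / (n : ℝ))) = ENNReal.ofReal (((2 * r) ^ α)⁻¹) := by
      rw [volume_cube c hr, ENNReal.ofReal_rpow_of_pos (by positivity), ← Real.rpow_natCast,
        ← Real.rpow_mul hs.le, ← Real.rpow_neg hs.le]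
      congr 2
      field_simp
    rw [h3]
    refine (mul_le_mul_right h1 _).trans (le_of_eq ?_)
    rw [← ENNReal.ofReal_mul (by positivity)]
    conv_rhs => rw [← ENNReal.ofReal_toReal hA]
    rw [← ENNReal.ofReal_mul hC.le]
    congr 1
    field_simp
end
end
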